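/- arXiv:1205.4091 — 2 statements merged into one kernel-verified Lean document; each statement's English description precedes it below -/
import Mathlib

section
/- Let p be a prime number, K a field of characteristic p, and s, t nonnegative integers. Consider the group G = K^s × (K^*)^t (the product of s copies of the additive group of K and t copies of the multiplicative group of K). Let X be the common zero set in K^{s+t} of a finite family of polynomials P_1,…,P_r in s+t variables, and let Γ be a finitely generated subgroup of G. Then the set S = {g ∈ Γ : P_1(g) = ⋯ = P_r(g) = 0} is a p-automatic subset of Γ: for every finite family γ_1,…,γ_m of elements generating the group Γ, the set of functions Γ → {0,1} of the form g ↦ χ_S(g^{p^a} · γ_1^{b_1} ⋯ γ_m^{b_m}), where a ∈ ℕ, 0 ≤ b_j < p^a, and powers and products are taken in the group G, is finite. -/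
universe u

/-- Coordinates of a field of characteristic `p` over its subfield of `p`-th powers, composed with
the `p`-th root. -/
theorem exists_frobenius_coordinates (F : Type u) [Field F] (p : ℕ) [Fact p.Prime]
    [CharP F p] : ∃ (ι : Type u) (φ : ι → F →+ F), (∀ i a x, φ i (a ^ p * x) = a * φ i x) ∧
      (∀ x, (∀ i, φ i x = 0) → x = 0) ∧ ∀ x, {i | φ i x ≠ 0}.Finite := by
  let B := Module.Basis.ofVectorSpace (frobenius F p).fieldRange F
  choose ψ hψ using fun i x => (B.repr x i).2
  have hinj : Function.Injective (frobenius F p) := frobenius_inj F p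
  refine ⟨_, fun i => ⟨⟨ψ i, hinj ?_⟩, fun x y => hinj ?_⟩, fun i a x => hinj ?_,
    fun x hx => ?_, fun x => ?_⟩
  · simp [hψ]
  · simp [hψ]
  · have h : a ^ p * x = (⟨frobenius F p a, (frobenius F p).mem_fieldRange_self a⟩ :
        (frobenius F p).fieldRange) • x := rfl
    change frobenius F p (ψ i (a ^ p * x)) = frobenius F p (a * ψ i x)
    rw [map_mul, hψ, hψ, h, map_smul]
    simp
  · apply B.repr.map_eq_zero_iff.mp
    ext i
    rw [← hψ]
    have : ψ i x = 0 := hx i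
    simp [this]
  · refine (B.repr x).support.finite_toSet.subset fun i hi => ?_
    simp only [Finset.mem_coe, Finsupp.mem_support_iff]
    intro h
    apply hi
    apply hinj
    change frobenius F p (ψ i x) = _
    simp [hψ, h]

/-- The span over the prime field of the monomials in `y` with all exponents at most `n`. -/
def monomialBoxSpan (p : ℕ) {F ι : Type*} [Field F] [Algebra (ZMod p) F] [Fintype ι] (y : ι → F)
    (n : ℕ) : Submodule (ZMod p) F :=
  Submodule.span (ZMod p) ((fun e : ι → ℕ => ∏ i, y i ^ e i) '' Set.Iic (fun _ => n))

namespace monomialBoxSpan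

variable {p : ℕ} {F ι : Type*} [Field F] [Algebra (ZMod p) F] [Fintype ι] {y : ι → F}

theorem finite [Fact p.Prime] (y : ι → F) (n : ℕ) : (monomialBoxSpan p y n : Set F).Finite := by
  classical
  have hfin : ((fun e : ι → ℕ => ∏ i, y i ^ e i) '' Set.Iic (fun _ => n)).Finite :=
    (Set.finite_Iic _).image _
  have : Module.Finite (ZMod p) (monomialBoxSpan p y n) := Module.Finite.span_of_finite _ hfin
  have : Finite (monomialBoxSpan p y n) := Module.finite_of_finite (ZMod p)
  exact Set.toFinite _

theorem mono (y : ι → F) : Monotone (monomialBoxSpan p y) := fun _ _ h =>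
  Submodule.span_mono (Set.image_mono (Set.Iic_subset_Iic.mpr fun _ => h))

theorem mul_mem {n k : ℕ} {a b : F} (ha : a ∈ monomialBoxSpan p y n)
    (hb : b ∈ monomialBoxSpan p y k) : a * b ∈ monomialBoxSpan p y (n + k) := by
  have h := Submodule.mul_mem_mul ha hb
  rw [monomialBoxSpan, monomialBoxSpan, Submodule.span_mul_span] at h
  refine Submodule.span_mono ?_ h
  rintro _ ⟨_, ⟨e, he, rfl⟩, _, ⟨d, hd, rfl⟩, rfl⟩
  exact ⟨e + d, fun i => add_le_add (he i) (hd i), by simp [pow_add, Finset.prod_mul_distrib]⟩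

theorem exists_mem (y : ι → F) {a : F} (ha : a ∈ Subring.closure (Set.range y)) :
    ∃ n, a ∈ monomialBoxSpan p y n := by
  classical
  induction ha using Subring.closure_induction with
  | mem x hx =>
    obtain ⟨i, rfl⟩ := hx
    refine ⟨1, Submodule.subset_span ⟨Pi.single i 1, fun j => ?_, ?_⟩⟩
    · by_cases h : j = i
      · subst h; simp
      · simp [h]
    · simp [Pi.single_apply, Finset.prod_ite_eq']
  | zero => exact ⟨0, zero_mem _⟩
  | one => exact ⟨0, Submodule.subset_span ⟨0, by simp, by simp⟩⟩
  | add a b _ _ ha hb =>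
    obtain ⟨n, hn⟩ := ha
    obtain ⟨k, hk⟩ := hb
    exact ⟨max n k, add_mem (mono y (le_max_left _ _) hn) (mono y (le_max_right _ _) hk)⟩
  | neg a _ ha => exact ha.imp fun n hn => neg_mem hn
  | mul a b _ _ ha hb =>
    obtain ⟨n, hn⟩ := ha
    obtain ⟨k, hk⟩ := hb
    exact ⟨n + k, mul_mem hn hk⟩

theorem exists_forall_mem (y : ι → F) {D : Set F} (hD : D.Finite)
    (h : ∀ d ∈ D, d ∈ Subring.closure (Set.range y)) :
    ∃ n, ∀ d ∈ D, d ∈ monomialBoxSpan p y n := by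
  induction D, hD using Set.Finite.induction_on with
  | empty => exact ⟨0, by simp⟩
  | @insert a s _ _ ih =>
    obtain ⟨n, hn⟩ := ih fun d hd => h d (Set.mem_insert_of_mem _ hd)
    obtain ⟨k, hk⟩ := exists_mem (p := p) y (h a (Set.mem_insert _ _))
    refine ⟨max n k, fun d hd => ?_⟩
    rcases hd with rfl | hd
    · exact mono y (le_max_right _ _) hk
    · exact mono y (le_max_left _ _) (hn d hd)

end monomialBoxSpan

theorem Subring.exists_common_denominator {F : Type*} [Field F] (A : Subring F)
    (hA : ∀ z : F, ∃ a ∈ A, ∃ b ∈ A, a / b = z) {D : Set F} (hD : D.Finite) :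
    ∃ f ∈ A, f ≠ 0 ∧ ∀ d ∈ D, f * d ∈ A := by
  induction D, hD using Set.Finite.induction_on with
  | empty => exact ⟨1, one_mem _, one_ne_zero, by simp⟩
  | @insert z s _ _ ih =>
    obtain ⟨f, hf, hf0, hfs⟩ := ih
    obtain ⟨a, ha, b, hb, rfl⟩ := hA z
    by_cases hb0 : b = 0
    · refine ⟨f, hf, hf0, ?_⟩
      rintro d (rfl | hd)
      · simp [hb0]
      · exact hfs d hd
    · refine ⟨f * b, mul_mem hf hb, mul_ne_zero hf0 hb0, ?_⟩
      rintro d (rfl | hd)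
      · rw [mul_assoc, mul_div_cancel₀ _ hb0]
        exact mul_mem hf ha
      · rw [mul_right_comm]
        exact mul_mem (hfs d hd) hb

theorem exists_finite_stable_set {F ι I : Type*} [Field F] [Fintype ι] (p : ℕ) [Fact p.Prime]
    [CharP F p] (y : ι → F)
    (hy : ∀ z : F, ∃ a ∈ Subring.closure (Set.range y), ∃ b ∈ Subring.closure (Set.range y),
      a / b = z)
    (φ : I → F →+ F) (hφ : ∀ i a x, φ i (a ^ p * x) = a * φ i x)
    (hφfin : ∀ x, {i | φ i x ≠ 0}.Finite) {D H : Set F} (hD : D.Finite) (hH : H.Finite)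
    (hDy : ∀ d ∈ D, d ∈ Subring.closure (Set.range y))
    (hHy : ∀ h ∈ H, h ∈ Subring.closure (Set.range y)) :
    ∃ V : Set F, V.Finite ∧ D ⊆ V ∧ ∀ i, ∀ h ∈ H, ∀ v ∈ V, φ i (h * v) ∈ V := by
  let := ZMod.algebra F p
  set A := Subring.closure (Set.range y)
  have hp : p.Prime := Fact.out
  let mon : (ι → ℕ) → F := fun e => ∏ i, y i ^ e i
  let E : Set F := ⋃ r ∈ Set.Iic (fun _ : ι => p), (fun i => φ i (mon r)) '' {i | φ i (mon r) ≠ 0}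
  classical
  have hE : E.Finite := (Set.finite_Iic _).biUnion fun r _ => (hφfin _).image _
  obtain ⟨f, hf, hf0, hfE⟩ := A.exists_common_denominator hy hE
  obtain ⟨c, hc⟩ := monomialBoxSpan.exists_forall_mem (p := p) y (hE.image (f * ·)) (by
    rintro _ ⟨d, hd, rfl⟩; exact hfE d hd)
  obtain ⟨k, hk⟩ := monomialBoxSpan.exists_forall_mem (p := p) y (hH.image (· * f ^ (p - 2))) (by
    rintro _ ⟨d, hd, rfl⟩; exact mul_mem (hHy d hd) (pow_mem hf _))
  obtain ⟨l, hl⟩ := monomialBoxSpan.exists_forall_mem (p := p) y (hD.image (f ^ 2 * ·)) (by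
    rintro _ ⟨d, hd, rfl⟩; exact mul_mem (pow_mem hf _) (hDy d hd))
  have hstep (i : I) (n : ℕ) (z : F) (hz : z ∈ monomialBoxSpan p y n) :
      f * φ i z ∈ monomialBoxSpan p y (n / p + c) := by
    induction hz using Submodule.span_induction with
    | mem z hz =>
      obtain ⟨e, he, rfl⟩ := hz
      let q : ι → ℕ := fun j => e j / p
      let r : ι → ℕ := fun j => e j % p
      have hqr : mon e = mon q ^ p * mon r := by
        simp only [mon, q, r, ← Finset.prod_pow, ← Finset.prod_mul_distrib]
        refine Finset.prod_congr rfl fun j _ => ?_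
        rw [← pow_mul, ← pow_add, Nat.div_add_mod']
      change f * φ i (mon e) ∈ _
      rw [hqr, hφ, mul_left_comm]
      refine monomialBoxSpan.mul_mem
        (Submodule.subset_span ⟨q, fun j => Nat.div_le_div_right (he j), rfl⟩) ?_
      by_cases h0 : φ i (mon r) = 0
      · rw [h0, mul_zero]; exact zero_mem _
      · refine hc _ ⟨_, Set.mem_biUnion (x := r) ?_ ⟨i, h0, rfl⟩, rfl⟩
        exact fun j => (Nat.mod_lt _ hp.pos).le
    | zero => simp
    | add a b _ _ ha hb => rw [map_add, mul_add]; exact add_mem ha hb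
    | smul t a _ ha =>
      rw [ZMod.map_smul, mul_smul_comm]
      exact Submodule.smul_mem _ _ ha
  let n := max l (k + 2 * c)
  refine ⟨{v | f ^ 2 * v ∈ monomialBoxSpan p y n},
    (monomialBoxSpan.finite y n).preimage (mul_right_injective₀ (pow_ne_zero 2 hf0)).injOn,
    fun d hd => monomialBoxSpan.mono y (le_max_left _ _) (hl _ ⟨d, hd, rfl⟩),
    fun i h hh v hv => ?_⟩
  have h1 : f ^ 2 * φ i (h * v) = f * φ i (h * f ^ (p - 2) * (f ^ 2 * v)) := by
    have : h * f ^ (p - 2) * (f ^ 2 * v) = f ^ p * (h * v) := by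
      rw [← Nat.sub_add_cancel hp.two_le, pow_add]
      simp only [Nat.add_sub_cancel]
      ring
    rw [this, hφ]
    ring
  change f ^ 2 * φ i (h * v) ∈ monomialBoxSpan p y n
  rw [h1]
  refine monomialBoxSpan.mono y ?_
    (hstep i _ _ (monomialBoxSpan.mul_mem (hk _ ⟨h, hh, rfl⟩) hv))
  have h2 : (k + n) / p ≤ (k + n) / 2 := Nat.div_le_div_left hp.two_le two_pos
  have h3 : k + 2 * c ≤ n := le_max_right _ _
  omega

/-- Zero sets of linear combinations of characters have finite `p`-kernel, over a field generated
by the coefficients and the values of the characters at the `γ j`. -/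
theorem finite_kernel_of_generating {F Γ ι κ : Type*} [Field F] [CommGroup Γ] [Fintype ι]
    [Fintype κ] (p : ℕ) [Fact p.Prime] [CharP F p] {m : ℕ} (γ : Fin m → Γ) (χ : ι → Γ →* F)
    (y : κ → F)
    (hy : ∀ z : F, ∃ a ∈ Subring.closure (Set.range y), ∃ b ∈ Subring.closure (Set.range y),
      a / b = z)
    {W : Set (ι → F)} (hW : W.Finite)
    (hWy : ∀ w ∈ W, ∀ i, w i ∈ Subring.closure (Set.range y))
    (hχy : ∀ i j, χ i (γ j) ∈ Subring.closure (Set.range y)) :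
    {T : Set Γ | ∃ U ⊆ W, ∃ (a : ℕ) (b : Fin m → ℕ), (∀ j, b j < p ^ a) ∧
      T = {x | ∀ w ∈ U, ∑ i, w i * χ i (x ^ p ^ a * ∏ j, γ j ^ b j) = 0}}.Finite := by
  classical
  obtain ⟨I, φ, hφ, hφ0, hφfin⟩ := exists_frobenius_coordinates F p
  have hp : p.Prime := Fact.out
  let H : Set F := ⋃ i, (fun b : Fin m → ℕ => χ i (∏ j, γ j ^ b j)) '' Set.Iic (fun _ => p)
  have hH : H.Finite := Set.finite_iUnion fun i => (Set.finite_Iic _).image _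
  let D : Set F := ⋃ i, (fun w : ι → F => w i) '' W
  have hD : D.Finite := Set.finite_iUnion fun i => hW.image _
  obtain ⟨V, hV, hDV, hφV⟩ := exists_finite_stable_set p y hy φ hφ hφfin hD hH
    (by
      intro d hd
      obtain ⟨i, w, hw, rfl⟩ := Set.mem_iUnion.mp hd
      exact hWy w hw i)
    (by
      intro h hh
      obtain ⟨i, b, -, rfl⟩ := Set.mem_iUnion.mp hh
      simp only [map_prod, map_pow]
      exact prod_mem fun j _ => pow_mem (hχy i j) _)
  let Z : Set (ι → F) → Set Γ := fun U => {x | ∀ w ∈ U, ∑ i, w i * χ i x = 0}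
  have hVfin : (Set.univ.pi fun _ : ι => V).Finite := Set.Finite.pi fun _ => hV
  have key (a : ℕ) : ∀ (U : Set (ι → F)), U ⊆ Set.univ.pi (fun _ => V) → ∀ b : Fin m → ℕ,
      (∀ j, b j < p ^ a) → ∃ U' ⊆ Set.univ.pi (fun _ : ι => V),
        {x | x ^ p ^ a * ∏ j, γ j ^ b j ∈ Z U} = Z U' := by
    induction a with
    | zero =>
      intro U hU b hb
      refine ⟨U, hU, ?_⟩
      have hb0 : ∀ j, b j = 0 := fun j => by simpa using hb j
      simp [hb0]
    | succ a ih =>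
      intro U hU b hb
      let g : Γ := ∏ j, γ j ^ (b j % p)
      let U₁ : Set (ι → F) := {u | ∃ w ∈ U, ∃ i, u = fun l => φ i (χ l g * w l)}
      have hU₁ : U₁ ⊆ Set.univ.pi (fun _ => V) := by
        rintro _ ⟨w, hw, i, rfl⟩ l -
        refine hφV i _ (Set.mem_iUnion.mpr ⟨l, fun j => b j % p, ?_, rfl⟩) _ (hU hw l trivial)
        exact fun j => (Nat.mod_lt _ hp.pos).le
      have hZ (x : Γ) : x ^ p * g ∈ Z U ↔ x ∈ Z U₁ := by
        have hsum (w : ι → F) (i : I) : φ i (∑ l, w l * χ l (x ^ p * g)) =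
            ∑ l, φ i (χ l g * w l) * χ l x := by
          rw [map_sum]
          refine Finset.sum_congr rfl fun l _ => ?_
          rw [(χ l).map_mul, (χ l).map_pow, mul_comm (φ i _), ← hφ]
          congr 1
          ring
        constructor
        · rintro h _ ⟨w, hw, i, rfl⟩
          rw [← hsum, h w hw, map_zero]
        · intro h w hw
          refine hφ0 _ fun i => ?_
          rw [hsum]
          exact h _ ⟨w, hw, i, rfl⟩
      obtain ⟨U', hU', h⟩ := ih U₁ hU₁ (fun j => b j / p) fun j =>
        Nat.div_lt_of_lt_mul (by rw [← pow_succ']; exact hb j)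
      refine ⟨U', hU', ?_⟩
      rw [← h]
      ext x
      change _ ∈ Z U ↔ _ ∈ Z U₁
      rw [← hZ]
      have : x ^ p ^ (a + 1) * ∏ j, γ j ^ b j = (x ^ p ^ a * ∏ j, γ j ^ (b j / p)) ^ p * g := by
        rw [mul_pow, ← pow_mul, ← pow_succ, mul_assoc, ← Finset.prod_pow]
        simp only [g]
        rw [← Finset.prod_mul_distrib]
        congr 1
        refine Finset.prod_congr rfl fun j _ => ?_
        rw [← pow_mul, ← pow_add, Nat.div_add_mod']
      rw [this]
  refine (hVfin.finite_subsets.image Z).subset ?_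
  rintro _ ⟨U, hU, a, b, hb, rfl⟩
  obtain ⟨U', hU', h⟩ := key a U
    (fun w hw i _ => hDV (Set.mem_iUnion.mpr ⟨i, w, hU hw, rfl⟩)) b hb
  exact ⟨U', hU', h.symm⟩

/-- Zero sets of linear combinations of characters of a finitely generated abelian group have
finite `p`-kernel. -/
theorem finite_kernel_of_characters {K Γ ι : Type*} [Field K] [CommGroup Γ] [Fintype ι]
    (p : ℕ) [Fact p.Prime] [CharP K p] {m : ℕ} (γ : Fin m → Γ)
    (hγ : Subgroup.closure (Set.range γ) = ⊤) (χ : ι → Γ →* K)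
    {W : Set (ι → K)} (hW : W.Finite) :
    {T : Set Γ | ∃ U ⊆ W, ∃ (a : ℕ) (b : Fin m → ℕ), (∀ j, b j < p ^ a) ∧
      T = {x | ∀ w ∈ U, ∑ i, w i * χ i (x ^ p ^ a * ∏ j, γ j ^ b j) = 0}}.Finite := by
  have := hW.fintype
  let y : (ι × W) ⊕ (ι × Fin m) → K :=
    Sum.elim (fun q => (q.2 : ι → K) q.1) (fun q => χ q.1 (γ q.2))
  let F : Subfield K := Subfield.closure (Set.range y)
  have hyF (q) : y q ∈ F := Subfield.subset_closure ⟨q, rfl⟩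
  have hχF (i : ι) (x : Γ) : χ i x ∈ F := by
    have hx : x ∈ Subgroup.closure (Set.range γ) := hγ ▸ Subgroup.mem_top x
    induction hx using Subgroup.closure_induction with
    | mem x hx =>
      obtain ⟨j, rfl⟩ := hx
      exact hyF (Sum.inr (i, j))
    | one => rw [map_one]; exact one_mem F
    | mul a b _ _ ha hb => rw [map_mul]; exact mul_mem ha hb
    | inv a _ ha =>
      have : χ i a⁻¹ = (χ i a)⁻¹ := by
        apply eq_inv_of_mul_eq_one_left
        rw [← map_mul, inv_mul_cancel, map_one]
      rw [this]
      exact inv_mem ha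
  let y' : (ι × W) ⊕ (ι × Fin m) → F := fun q => ⟨y q, hyF q⟩
  have hmap : Subring.closure (Set.range y) = (Subring.closure (Set.range y')).map F.subtype := by
    rw [RingHom.map_closure, ← Set.range_comp]
    rfl
  have hy' (z : F) : ∃ a ∈ Subring.closure (Set.range y'),
      ∃ b ∈ Subring.closure (Set.range y'), a / b = z := by
    obtain ⟨a, ha, b, hb, h⟩ := Subfield.mem_closure_iff.mp z.2
    rw [hmap] at ha hb
    obtain ⟨a', ha', rfl⟩ := ha
    obtain ⟨b', hb', rfl⟩ := hb
    exact ⟨a', ha', b', hb', Subtype.ext h⟩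
  let c : (ι → F) → (ι → K) := fun w i => w i
  have hc : Function.Injective c := fun u v h => funext fun i => Subtype.ext (congrFun h i)
  have := finite_kernel_of_generating p γ (fun i => (χ i).codRestrict F (hχF i)) y' hy'
    (W := c ⁻¹' W) (hW.preimage hc.injOn)
    (fun w hw i => Subring.subset_closure ⟨Sum.inl (i, ⟨c w, hw⟩), rfl⟩)
    (fun i j => Subring.subset_closure ⟨Sum.inr (i, j), rfl⟩)
  refine this.subset ?_
  rintro _ ⟨U, hU, a, b, hb, rfl⟩
  refine ⟨c ⁻¹' U, Set.preimage_mono hU, a, b, hb, ?_⟩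
  ext x
  have hsum (w : ι → F) (g : Γ) :
      ∑ i, w i * (χ i).codRestrict F (hχF i) g = 0 ↔ ∑ i, c w i * χ i g = 0 := by
    rw [← Subtype.coe_inj]
    simp [c]
  constructor
  · intro h w hw
    exact (hsum w _).mpr (h _ hw)
  · intro h w hw
    have : c (fun i => ⟨w i, hyF (Sum.inl (i, ⟨w, hU hw⟩))⟩) = w := rfl
    rw [← this]
    exact (hsum _ _).mp (h _ (by rw [Set.mem_preimage, this]; exact hw))


/-- let `G = K^s × (K^*)^t` over a field `K` of characteristic `p`,
`X` the common zero set of polynomials `P_1,…,P_r` in `s + t` variables, and `Γ`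
a finitely generated subgroup of `G`. Then `{g ∈ Γ : P_1(g) = ⋯ = P_r(g) = 0}`
is a `p`-automatic subset of `Γ`. -/
theorem variety_inter_fg_subgroup_of_torus_automatic
    (p : ℕ) (hp : p.Prime) (K : Type*) [Field K] [CharP K p]
    (s t : ℕ)
    (r : ℕ) (P : Fin r → MvPolynomial (Fin (s + t)) K)
    (Γ : Subgroup (Multiplicative (Fin s → K) × (Fin t → Kˣ)))
    (hFG : Group.FG ↥Γ) :
    ∀ (m : ℕ) (γ : Fin m → ↥Γ),
      Subgroup.closure (Set.range γ) = ⊤ →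
      Set.Finite { T : Set ↥Γ |
        ∃ (a : ℕ) (b : Fin m → ℕ), (∀ j, b j < p ^ a) ∧
          T = { x : ↥Γ |
            x ^ (p ^ a) * ∏ j : Fin m, γ j ^ b j ∈
              { g : ↥Γ | ∀ k : Fin r,
                MvPolynomial.eval
                  (fun i : Fin (s + t) =>
                    Fin.addCases (motive := fun _ => K)
                      (fun i₁ => Multiplicative.toAdd
                        ((g : Multiplicative (Fin s → K) × (Fin t → Kˣ)).1) i₁)
                      (fun i₂ =>
                        (((g : Multiplicative (Fin s → K) × (Fin t → Kˣ)).2 i₂ : Kˣ) : K))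
                      i)
                  (P k) = 0 } } } := by
  intro m γ hγ
  classical
  have : Fact p.Prime := ⟨hp⟩
  let M : Finset (Fin (s + t) →₀ ℕ) := Finset.univ.biUnion fun k => (P k).support
  let χ : M → Γ →* K := fun β =>
    { toFun := fun g => ∏ j, ((g : Multiplicative (Fin s → K) × (Fin t → Kˣ)).2 j : K) ^
        (β : Fin (s + t) →₀ ℕ) (Fin.natAdd s j)
      map_one' := by simp
      map_mul' := fun g h => by simp [mul_pow, Finset.prod_mul_distrib] }
  let w : Fin r → (Fin s → K) → M → K := fun k c β =>
    (P k).coeff β * ∏ i, c i ^ (β : Fin (s + t) →₀ ℕ) (Fin.castAdd t i)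
  let u : Γ → Fin s → K := fun g => Multiplicative.toAdd g.1.1
  have heval (k : Fin r) (g : Γ) : MvPolynomial.eval
      (fun i : Fin (s + t) => Fin.addCases (motive := fun _ => K)
        (fun i₁ => Multiplicative.toAdd
          ((g : Multiplicative (Fin s → K) × (Fin t → Kˣ)).1) i₁)
        (fun i₂ => (((g : Multiplicative (Fin s → K) × (Fin t → Kˣ)).2 i₂ : Kˣ) : K)) i) (P k) =
      ∑ β, w k (u g) β * χ β g := by
    rw [MvPolynomial.eval_eq', Finset.sum_subset
      (Finset.subset_biUnion_of_mem (fun k => (P k).support) (Finset.mem_univ k))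
      (fun β _ hβ => by rw [MvPolynomial.notMem_support_iff.mp hβ, zero_mul]),
      ← Finset.sum_coe_sort]
    refine Finset.sum_congr rfl fun β _ => ?_
    rw [Fin.prod_univ_add]
    simp [w, χ, u, mul_assoc]
  let C : Set (Fin s → K) := (fun b : Fin m → ℕ => ∑ j, b j • u (γ j)) '' Set.Iic fun _ => p
  have hC : C.Finite := (Set.finite_Iic _).image _
  have hsmul (n : ℕ) (v : Fin s → K) : (n % p) • v = n • v := by
    ext i
    simp only [Pi.smul_apply, nsmul_eq_mul]
    rw [CharP.cast_eq_mod K p n]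
  have hu (x : Γ) (a : ℕ) (b : Fin m → ℕ) : u (x ^ p ^ (a + 1) * ∏ j, γ j ^ b j) =
      ∑ j, (b j % p) • u (γ j) := by
    have hu' (x y : Γ) : u (x * y) = u x + u y := rfl
    let uh : Γ →* Multiplicative (Fin s → K) := (MonoidHom.fst _ _).comp Γ.subtype
    have h1 : u (x ^ p ^ (a + 1)) = p ^ (a + 1) • u x := congrArg Multiplicative.toAdd
      (map_pow uh x _)
    have h2 : u (∏ j, γ j ^ b j) = ∑ j, b j • u (γ j) := by
      have := congrArg Multiplicative.toAdd (map_prod uh (fun j => γ j ^ b j) Finset.univ)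
      simp only [map_pow, toAdd_prod, toAdd_pow] at this
      exact this
    rw [hu', h1, h2, ← hsmul, pow_succ, Nat.mul_mod_left, zero_smul, zero_add]
    simp only [hsmul]
  let W : Set (M → K) := ⋃ k, w k '' C
  have hW : W.Finite := Set.finite_iUnion fun k => hC.image _
  refine ((finite_kernel_of_characters p γ hγ χ hW).union (Set.finite_singleton
    {x : Γ | ∀ k, ∑ β, w k (u x) β * χ β x = 0})).subset ?_
  rintro _ ⟨a, b, hb, rfl⟩
  simp only [Set.mem_ofPred_eq, heval]
  rcases a with _ | a
  · right
    have hb0 : ∀ j, b j = 0 := fun j => by simpa using hb j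
    simp [hb0]
  · left
    let c : Fin s → K := ∑ j, (b j % p) • u (γ j)
    have hc : c ∈ C := ⟨fun j => b j % p, fun j => (Nat.mod_lt _ hp.pos).le, rfl⟩
    refine ⟨Set.range fun k => w k c, ?_, a + 1, b, hb, ?_⟩
    · rintro _ ⟨k, rfl⟩
      exact Set.mem_iUnion.mpr ⟨k, c, hc, rfl⟩
    · simp only [hu, Set.forall_mem_range, c]
end

section
/- Let p be a prime number, K a perfect field of characteristic p, and d a positive integer. Let f ∈ K[[t_1,…,t_d]] be a nonzero power series that is algebraic over K(t_1,…,t_d). Then there exist a positive integer r and polynomials P_0, P_1, …, P_r ∈ K[t_1,…,t_d] such that Σ_{i=0}^r P_i · f^{p^i} = 0 in K[[t_1,…,t_d]] and P_0 ≠ 0. -/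
namespace MvPowerSeries

variable {σ R : Type*} [CommRing R]

/-- The `R`-linear map keeping the coefficients whose exponents are of the form `p • n + e`. -/
noncomputable def residueSection (p : ℕ) (e : σ →₀ ℕ) :
    MvPowerSeries σ R →ₗ[R] MvPowerSeries σ R where
  toFun g := fun n => coeff (p • n + e) g
  map_add' _ _ := rfl
  map_smul' _ _ := rfl

theorem coeff_residueSection (p : ℕ) (e : σ →₀ ℕ) (g : MvPowerSeries σ R) (n : σ →₀ ℕ) :
    coeff n (residueSection p e g) = coeff (p • n + e) g := rfl

theorem residueSection_expand_mul {p : ℕ} (hp : p ≠ 0) {e : σ →₀ ℕ} (he : ∀ i, e i < p)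
    (u h : MvPowerSeries σ R) :
    residueSection p e (expand p hp u * h) = u * residueSection p e h := by
  classical
  ext n
  rw [coeff_residueSection, coeff_mul, coeff_mul]
  symm
  refine Finset.sum_of_injOn (fun x => (p • x.1, p • x.2 + e)) ?_ ?_ ?_ ?_
  · rintro ⟨a, b⟩ - ⟨a', b'⟩ - h
    simp only [Prod.mk.injEq, add_left_inj, nsmul_right_inj hp] at h
    simp [h.1, h.2]
  · rintro ⟨a, b⟩ hab
    simp only [Finset.mem_coe, Finset.HasAntidiagonal.mem_antidiagonal] at hab ⊢
    rw [← hab, smul_add, add_assoc]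
  · rintro ⟨a, b⟩ hab hnot
    rw [Finset.HasAntidiagonal.mem_antidiagonal] at hab
    by_cases hdvd : ∀ i, p ∣ a i
    · exfalso
      apply hnot
      obtain ⟨a', rfl⟩ : ∃ a' : σ →₀ ℕ, a = p • a' :=
        ⟨a.mapRange (· / p) (by simp), by ext i; simp [Nat.mul_div_cancel' (hdvd i)]⟩
      have hle : a' ≤ n := fun i => by
        have h1 := DFunLike.congr_fun hab i
        simp only [Finsupp.add_apply, Finsupp.smul_apply, smul_eq_mul] at h1
        have h2 := he i
        by_contra! hlt
        have h3 : p * (n i + 1) ≤ p * a' i := Nat.mul_le_mul_left p hlt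
        rw [mul_add] at h3
        omega
      refine ⟨(a', n - a'), by simp [add_tsub_cancel_of_le hle], ?_⟩
      have hb : p • a' + b = p • a' + (p • (n - a') + e) := by
        rw [hab, ← add_assoc, ← smul_add, add_tsub_cancel_of_le hle]
      simp [add_left_cancel hb]
    · push Not at hdvd
      obtain ⟨i, hi⟩ := hdvd
      simp [coeff_expand_of_not_dvd p hp u hi]
  · rintro ⟨a, b⟩ -
    simp [coeff_expand_smul, coeff_residueSection]

variable (p : ℕ) [ExpChar R p] [PerfectRing R p]

/-- The Cartier operator attached to the residue `e`: the `p`-th root of the part of a power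
series with exponents of the form `p • n + e`. -/
noncomputable def cartier (e : σ →₀ ℕ) : MvPowerSeries σ R →+ MvPowerSeries σ R :=
  (map ((frobeniusEquiv R p).symm : R →+* R)).toAddMonoidHom.comp
    (residueSection p e).toAddMonoidHom

theorem coeff_cartier (e : σ →₀ ℕ) (g : MvPowerSeries σ R) (n : σ →₀ ℕ) :
    coeff n (cartier p e g) = (frobeniusEquiv R p).symm (coeff (p • n + e) g) := rfl

theorem cartier_mul_pow {e : σ →₀ ℕ} (he : ∀ i, e i < p) (g h : MvPowerSeries σ R) :
    cartier p e (h * g ^ p) = cartier p e h * g := by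
  have hp : p ≠ 0 := expChar_ne_zero R p
  have key : map ((frobeniusEquiv R p).symm : R →+* R)
      (residueSection p e (g ^ p * h)) =
      g * map ((frobeniusEquiv R p).symm : R →+* R) (residueSection p e h) := by
    rw [← map_frobenius_expand p hp, map_expand, residueSection_expand_mul hp he, map_mul]
    congr 1
    ext n
    simp
  rw [mul_comm h, mul_comm _ g]
  exact key

theorem exists_coe_eq_cartier (e : σ →₀ ℕ) (P : MvPolynomial σ R) :
    ∃ Q : MvPolynomial σ R, (Q : MvPowerSeries σ R) = cartier p e P := by
  classical
  have hp : p ≠ 0 := expChar_ne_zero R p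
  have hfin : {n | coeff n (cartier p e (P : MvPowerSeries σ R)) ≠ 0}.Finite := by
    refine (P.support.finite_toSet.preimage (f := fun n => p • n + e) ?_).subset ?_
    · intro a _ b _ hab
      simpa [nsmul_right_inj hp] using hab
    · intro n hn
      simpa [coeff_cartier] using hn
  refine ⟨∑ n ∈ hfin.toFinset, MvPolynomial.monomial n
    (coeff n (cartier p e (P : MvPowerSeries σ R))), ?_⟩
  ext n
  simp only [MvPolynomial.coeff_coe, MvPolynomial.coeff_sum, MvPolynomial.coeff_monomial,
    Finset.sum_ite_eq', Set.Finite.mem_toFinset, Set.mem_ofPred_eq, ite_not]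
  split_ifs with h
  · exact h.symm
  · rfl

theorem exists_cartier_ne_zero {g : MvPowerSeries σ R} (hg : g ≠ 0) :
    ∃ e : σ →₀ ℕ, (∀ i, e i < p) ∧ cartier p e g ≠ 0 := by
  have hp : p ≠ 0 := expChar_ne_zero R p
  obtain ⟨m, hm⟩ := (ne_zero_iff_exists_coeff_ne_zero g).1 hg
  refine ⟨m.mapRange (· % p) (by simp), fun i => ?_, fun h => hm ?_⟩
  · exact Nat.mod_lt (m i) (Nat.pos_of_ne_zero hp)
  · have hdecomp : p • m.mapRange (· / p) (by simp) + m.mapRange (· % p) (by simp) = m := by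
      ext i
      exact Nat.div_add_mod (m i) p
    have := congrArg (coeff (m.mapRange (· / p) (by simp))) h
    rw [coeff_cartier, hdecomp] at this
    simpa using this

/-- A relation among the iterated `p`-th powers of `f` can be replaced by one with nonzero
initial coefficient. -/
theorem exists_frobenius_relation_of_lowest (f : MvPowerSeries σ R) (j : ℕ) :
    ∀ (N : ℕ) (P : ℕ → MvPolynomial σ R), j ≤ N → P j ≠ 0 → (∀ i < j, P i = 0) →
      ∑ i ∈ Finset.range (N + 1), (P i : MvPowerSeries σ R) * f ^ p ^ i = 0 →
      ∃ (r : ℕ) (Q : ℕ → MvPolynomial σ R), Q 0 ≠ 0 ∧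
        ∑ i ∈ Finset.range (r + 1), (Q i : MvPowerSeries σ R) * f ^ p ^ i = 0 := by
  induction j with
  | zero => exact fun N P _ h0 _ hsum => ⟨N, P, h0, hsum⟩
  | succ j ih =>
    intro N P hN hj hlow hsum
    obtain ⟨N, rfl⟩ : ∃ M, N = M + 1 := ⟨N - 1, by omega⟩
    obtain ⟨e, he, hne⟩ := exists_cartier_ne_zero p
      (mt MvPolynomial.coe_eq_zero_iff.1 hj : (P (j + 1) : MvPowerSeries σ R) ≠ 0)
    choose Q hQ using fun i => exists_coe_eq_cartier p e (P (i + 1))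
    refine ih N Q (by omega) ?_ (fun i hi => ?_) ?_
    · rintro h
      exact hne (by rw [← hQ, h, MvPolynomial.coe_zero])
    · rw [← MvPolynomial.coe_eq_zero_iff, hQ, hlow _ (by omega), MvPolynomial.coe_zero, map_zero]
    · rw [Finset.sum_range_succ', hlow 0 (by omega), MvPolynomial.coe_zero, zero_mul,
        add_zero] at hsum
      have := congrArg (cartier p e) hsum
      simpa only [map_sum, map_zero, pow_succ, pow_mul, cartier_mul_pow p he, ← hQ] using this

end MvPowerSeries

/-- The powers of an algebraic element along an arbitrary sequence of exponents are linearly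
dependent over the base domain. -/
theorem IsAlgebraic.not_linearIndependent_pow {A L : Type*} [CommRing A] [IsDomain A]
    [Field L] [Algebra A L] [FaithfulSMul A L] {x : L} (hx : IsAlgebraic A x)
    (u : ℕ → ℕ) : ¬ LinearIndependent A fun i => x ^ u i := by
  intro h
  let F := FractionRing A
  let : Algebra F L := FractionRing.liftAlgebra A L
  have : IsScalarTower A F L := FractionRing.isScalarTower_liftAlgebra A L
  rw [LinearIndependent.iff_fractionRing A F] at h
  have hy : IsIntegral F x := (hx.extendScalars (IsFractionRing.injective A F)).isIntegral
  have : Module.Finite F (Algebra.adjoin F {x}) := Module.Finite.iff_fg.2 hy.fg_adjoin_singleton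
  have hsub : LinearIndependent F fun i : ℕ =>
      (⟨x ^ u i, pow_mem (Algebra.self_mem_adjoin_singleton F _) _⟩ : Algebra.adjoin F {x}) :=
    LinearIndependent.of_comp (Algebra.adjoin F {x}).val.toLinearMap h
  exact not_finite_iff_infinite.2 inferInstance hsub.finite

/-- The powers of an algebraic element of a domain along an arbitrary sequence of exponents are
linearly dependent over the base domain. -/
theorem IsAlgebraic.not_linearIndependent_pow_of_isDomain {A B : Type*} [CommRing A] [IsDomain A]
    [CommRing B] [IsDomain B] [Algebra A B] [FaithfulSMul A B] {x : B} (hx : IsAlgebraic A x)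
    (u : ℕ → ℕ) : ¬ LinearIndependent A fun i => x ^ u i := by
  intro h
  have : FaithfulSMul A (FractionRing B) := FaithfulSMul.trans A B (FractionRing B)
  refine (hx.algebraMap (A := FractionRing B)).not_linearIndependent_pow u ?_
  have := h.map' (IsScalarTower.toAlgHom A B (FractionRing B)).toLinearMap
    (LinearMap.ker_eq_bot.2 (IsFractionRing.injective B (FractionRing B)))
  simpa [Function.comp_def] using this

/-- Ore's lemma: a nonzero multivariate power series over a
perfect field of characteristic `p` that is algebraic over the rational function
field satisfies a relation `Σ_{i=0}^r P_i f^{p^i} = 0` with `P_0 ≠ 0`. -/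
theorem ore_lemma
    (p : ℕ) (hp : p.Prime) (K : Type*) [Field K] [CharP K p]
    (hperf : Function.Surjective fun x : K => x ^ p)
    (d : ℕ) (hd : 0 < d)
    (f : MvPowerSeries (Fin d) K) (hf : f ≠ 0)
    (halg : ∃ m : ℕ, ∃ A : Fin (m + 1) → MvPolynomial (Fin d) K,
        (∃ i, A i ≠ 0) ∧
        ∑ i : Fin (m + 1), (A i : MvPowerSeries (Fin d) K) * f ^ (i : ℕ) = 0) :
    ∃ (r : ℕ) (P : Fin (r + 1) → MvPolynomial (Fin d) K),
      0 < r ∧ P 0 ≠ 0 ∧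
      ∑ i : Fin (r + 1), (P i : MvPowerSeries (Fin d) K) * f ^ (p ^ (i : ℕ)) = 0 := by
  have : ExpChar K p := .prime hp
  have : PerfectRing K p := .ofSurjective K p hperf
  have halgebraMap (P : MvPolynomial (Fin d) K) :
      algebraMap (MvPolynomial (Fin d) K) (MvPowerSeries (Fin d) K) P = P := by
    simp [MvPowerSeries.algebraMap_apply']
  have : FaithfulSMul (MvPolynomial (Fin d) K) (MvPowerSeries (Fin d) K) := by
    rw [faithfulSMul_iff_algebraMap_injective]
    intro P Q h
    simpa only [halgebraMap, MvPolynomial.coe_inj] using h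
  have hfalg : IsAlgebraic (MvPolynomial (Fin d) K) f := by
    obtain ⟨m, A, ⟨i, hi⟩, hA⟩ := halg
    refine ⟨∑ i : Fin (m + 1), Polynomial.monomial i (A i), fun h => hi ?_, ?_⟩
    · have := congrArg (Polynomial.coeff · (i : ℕ)) h
      simpa [Polynomial.finsetSum_coeff, Polynomial.coeff_monomial, Fin.val_inj] using this
    · simpa [Polynomial.aeval_monomial, halgebraMap] using hA
  have : IsDomain (MvPowerSeries (Fin d) K) := NoZeroDivisors.to_isDomain _
  have hdep := hfalg.not_linearIndependent_pow_of_isDomain (p ^ ·)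
  rw [linearIndependent_iff] at hdep
  push Not at hdep
  obtain ⟨l, hl, hl0⟩ := hdep
  have hex : ∃ i, l i ≠ 0 := Finsupp.ne_iff.1 hl0
  classical
  have hmem : Nat.find hex ∈ l.support := Finsupp.mem_support_iff.2 (Nat.find_spec hex)
  obtain ⟨r, Q, hQ0, hQ⟩ := MvPowerSeries.exists_frobenius_relation_of_lowest p f (Nat.find hex)
    (l.support.sup id) l (Finset.le_sup (f := id) hmem) (Nat.find_spec hex)
    (fun i hi => not_not.1 (Nat.find_min hex hi)) <| by
      rw [Finsupp.linearCombination_apply, Finsupp.sum_of_support_subset l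
        (s := Finset.range (l.support.sup id + 1)) _ _ (by simp)] at hl
      · simpa only [Algebra.smul_def, halgebraMap] using hl
      · intro i hi
        exact Finset.mem_range_succ_iff.2 (Finset.le_sup (f := id) hi)
  refine ⟨r, fun i => Q i, Nat.pos_of_ne_zero ?_, hQ0, ?_⟩
  · rintro rfl
    simp [hf, hQ0] at hQ
  · rw [← hQ, Finset.sum_range]
end
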